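/- arXiv:1803.08735 — 9 statements merged into one kernel-verified Lean document; each statement's English description precedes it below -/
import Mathlib

section
/- Let n ≥ 2 be an integer. For every function w : Fin n → ℝ with w j ≥ 0 for all j and ∑ⱼ w j = 1, one has -Real.sqrt (w 0 * w 1) + ∑ⱼ (w j)^2 ≥ (2 - n) / (8 * n). Moreover, equality holds at the point w given by w 0 = w 1 = (n + 2) / (4 * n) and w j = 1 / (2 * n) for all j ≥ 2. -/
open Finset

theorem stmt_0 (n : ℕ) (hn : 2 ≤ n) :
    (∀ w : Fin n → ℝ, (∀ j, 0 ≤ w j) → ∑ j, w j = 1 →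
      -Real.sqrt (w ⟨0, by omega⟩ * w ⟨1, by omega⟩) + ∑ j, (w j) ^ 2 ≥
        ((2 : ℝ) - n) / (8 * n)) ∧
    (∀ w : Fin n → ℝ,
      w ⟨0, by omega⟩ = ((n : ℝ) + 2) / (4 * n) →
      w ⟨1, by omega⟩ = ((n : ℝ) + 2) / (4 * n) →
      (∀ j : Fin n, 2 ≤ (j : ℕ) → w j = 1 / (2 * n)) →
      -Real.sqrt (w ⟨0, by omega⟩ * w ⟨1, by omega⟩) + ∑ j, (w j) ^ 2 =
        ((2 : ℝ) - n) / (8 * n)) := by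
  obtain ⟨m, rfl⟩ : ∃ m, n = m + 2 := ⟨n - 2, by omega⟩
  have sum_split (f : Fin (m + 2) → ℝ) :
      ∑ j, f j = f ⟨0, by omega⟩ + f ⟨1, by omega⟩ + ∑ j : Fin m, f j.succ.succ := by
    rw [Fin.sum_univ_succ, Fin.sum_univ_succ, ← add_assoc]
    rfl
  constructor
  · intro w hw hsum
    rw [sum_split] at hsum ⊢
    have ha := hw ⟨0, by omega⟩
    have hb := hw ⟨1, by omega⟩
    generalize w ⟨0, by omega⟩ = a at *
    generalize w ⟨1, by omega⟩ = b at *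
    have amgm : Real.sqrt (a * b) ≤ (a + b) / 2 :=
      Real.sqrt_le_iff.mpr ⟨by positivity, by nlinarith [sq_nonneg (a - b)]⟩
    have tangent (c x : ℝ) : 2 * c * x - c ^ 2 ≤ x ^ 2 := by nlinarith [sq_nonneg (x - c)]
    have tail : 2 * (1 / (2 * ((m : ℝ) + 2))) * ∑ j : Fin m, w j.succ.succ
        - m * (1 / (2 * ((m : ℝ) + 2))) ^ 2 ≤ ∑ j : Fin m, w j.succ.succ ^ 2 := by
      have h := Finset.sum_le_sum fun (j : Fin m) (_ : j ∈ univ) =>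
        tangent (1 / (2 * ((m : ℝ) + 2))) (w j.succ.succ)
      simpa [Finset.sum_sub_distrib, ← Finset.mul_sum] using h
    have hs : ∑ j : Fin m, w j.succ.succ = 1 - a - b := by linarith
    rw [hs] at tail
    have hta := tangent (((m : ℝ) + 4) / (4 * (m + 2))) a
    have htb := tangent (((m : ℝ) + 4) / (4 * (m + 2))) b
    have value : -(a + b) / 2
        + (2 * (((m : ℝ) + 4) / (4 * (m + 2))) * a - (((m : ℝ) + 4) / (4 * (m + 2))) ^ 2)
        + (2 * (((m : ℝ) + 4) / (4 * (m + 2))) * b - (((m : ℝ) + 4) / (4 * (m + 2))) ^ 2)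
        + (2 * (1 / (2 * ((m : ℝ) + 2))) * (1 - a - b) - m * (1 / (2 * ((m : ℝ) + 2))) ^ 2)
        = ((2 : ℝ) - (m + 2 : ℕ)) / (8 * (m + 2 : ℕ)) := by
      push_cast
      field_simp
      ring
    linarith
  · intro w h0 h1 hw
    have tail : ∑ j : Fin m, w j.succ.succ ^ 2 = m * (1 / (2 * ((m + 2 : ℕ) : ℝ))) ^ 2 := by
      rw [Finset.sum_congr rfl fun j _ => by rw [hw j.succ.succ (by simp)]]
      simp
    rw [sum_split, tail, h0, h1, Real.sqrt_mul_self (by positivity)]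
    push_cast
    field_simp
    ring
end

section
/- Let n ≥ 2 be an even integer. Let X, N be n×n complex matrices that are skew-Hermitian (Xᴴ = -X, Nᴴ = -N) with trace X = trace N = 0, and suppose trace (X^2) = -1, trace (N^2) = -1, and trace (X*N) = 0. Then the real part of trace ((X*N)^2 + N^4) is at least (2 - n) / (8 * n). -/
open Matrix

/-- If the squares of the real numbers `a k` sum to one, then the product of any two of them is
bounded below in terms of the sum of the fourth powers. -/
theorem mul_add_sum_pow_four_ge {n : ℕ} (hn : 2 ≤ n) (a : Fin n → ℝ)
    (ha : ∑ k, a k ^ 2 = 1) (i j : Fin n) :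
    ((2 : ℝ) - n) / (8 * n) ≤ a i * a j + ∑ k, a k ^ 4 := by
  have hn' : (2 : ℝ) ≤ n := by exact_mod_cast hn
  obtain rfl | hij := eq_or_ne i j
  · calc ((2 : ℝ) - n) / (8 * n) ≤ 0 :=
        div_nonpos_of_nonpos_of_nonneg (by linarith) (by positivity)
      _ ≤ a i * a i + ∑ k, a k ^ 4 :=
        add_nonneg (mul_self_nonneg _) (Finset.sum_nonneg fun k _ => by positivity)
  obtain ⟨x, hx⟩ : ∃ x : ℝ, x = 1 / n := ⟨_, rfl⟩
  have hnx : n * x = 1 := by rw [hx]; field_simp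
  have hc : ((2 : ℝ) - n) / (8 * n) = x / 4 - 1 / 8 := by rw [hx]; field_simp; ring
  have hs : a i ^ 2 + a j ^ 2 ≤ 1 := by
    rw [← ha, ← Finset.sum_pair (f := fun k => a k ^ 2) hij]
    exact Finset.sum_le_sum_of_subset_of_nonneg (Finset.subset_univ _)
      fun k _ _ => sq_nonneg _
  have hq : (a i ^ 2 - x / 2) ^ 2 + (a j ^ 2 - x / 2) ^ 2 ≤ ∑ k, (a k ^ 2 - x / 2) ^ 2 := by
    rw [← Finset.sum_pair (f := fun k => (a k ^ 2 - x / 2) ^ 2) hij]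
    exact Finset.sum_le_sum_of_subset_of_nonneg (Finset.subset_univ _)
      fun k _ _ => sq_nonneg _
  have he : ∑ k, (a k ^ 2 - x / 2) ^ 2 = ∑ k, a k ^ 4 - 3 / 4 * x := by
    have : ∀ k, (a k ^ 2 - x / 2) ^ 2 = a k ^ 4 - x * a k ^ 2 + x ^ 2 / 4 := fun k => by ring
    simp only [this, Finset.sum_add_distrib, Finset.sum_sub_distrib, ← Finset.mul_sum, ha,
      Finset.sum_const, Finset.card_univ, Fintype.card_fin, nsmul_eq_mul]
    linear_combination x / 4 * hnx
  have hp : 0 ≤ (a i + a j) ^ 2 * (1 + (a i - a j) ^ 2) := by positivity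
  rw [hc]
  nlinarith [sq_nonneg (a i ^ 2 + a j ^ 2 - x - 1 / 2)]

theorem trace_sq_eq_neg_sum_normSq {n : ℕ} {X : Matrix (Fin n) (Fin n) ℂ} (hX : Xᴴ = -X) :
    trace (X ^ 2) = -((∑ i, ∑ j, Complex.normSq (X i j) : ℝ) : ℂ) := by
  have h : ∀ i j, X j i = -star (X i j) := fun i j => by
    rw [← conjTranspose_apply, hX, neg_apply, neg_neg]
  simp only [trace, diag_apply, pow_two, mul_apply]
  push_cast
  simp_rw [← Finset.sum_neg_distrib]
  refine Finset.sum_congr rfl fun i _ => Finset.sum_congr rfl fun j _ => ?_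
  rw [h i j, Complex.normSq_eq_conj_mul_self, Complex.star_def]
  ring

theorem trace_mul_diagonal_sq {n : ℕ} {X : Matrix (Fin n) (Fin n) ℂ} (hX : Xᴴ = -X)
    (a : Fin n → ℝ) :
    trace ((X * diagonal fun i => -Complex.I * a i) ^ 2) =
      ((∑ i, ∑ j, Complex.normSq (X i j) * (a i * a j) : ℝ) : ℂ) := by
  have h : ∀ i j, X j i = -star (X i j) := fun i j => by
    rw [← conjTranspose_apply, hX, neg_apply, neg_neg]
  simp only [trace, diag_apply, pow_two, mul_apply (M := X * _), mul_diagonal]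
  push_cast
  refine Finset.sum_congr rfl fun i _ => Finset.sum_congr rfl fun j _ => ?_
  rw [h i j, Complex.normSq_eq_conj_mul_self, Complex.star_def]
  linear_combination (-(X i j) * (starRingEnd ℂ) (X i j) * a i * a j) * Complex.I_mul_I

theorem trace_add_pow_four_ge_of_diagonal {n : ℕ} (hn : 2 ≤ n) {X : Matrix (Fin n) (Fin n) ℂ}
    (hX : Xᴴ = -X) (hX2 : trace (X ^ 2) = -1) (a : Fin n → ℝ)
    (ha : trace ((diagonal fun i => -Complex.I * (a i : ℂ)) ^ 2) = -1) :
    ((2 : ℝ) - n) / (8 * n) ≤ (trace ((X * diagonal fun i => -Complex.I * a i) ^ 2 +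
      (diagonal fun i => -Complex.I * (a i : ℂ)) ^ 4)).re := by
  have hw : ∑ i, ∑ j, Complex.normSq (X i j) = 1 := by
    rw [trace_sq_eq_neg_sum_normSq hX, neg_inj] at hX2
    exact_mod_cast hX2
  have ha2 : ∑ k, a k ^ 2 = 1 := by
    simp only [diagonal_pow, trace_diagonal, Pi.pow_apply, mul_pow, neg_sq, Complex.I_sq,
      neg_one_mul, Finset.sum_neg_distrib, neg_inj] at ha
    exact_mod_cast ha
  have h4 : trace ((diagonal fun i => -Complex.I * (a i : ℂ)) ^ 4) =
      ((∑ k, a k ^ 4 : ℝ) : ℂ) := by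
    simp [diagonal_pow, trace_diagonal, mul_pow, Even.neg_pow (by decide : Even 4)]
  rw [trace_add, trace_mul_diagonal_sq hX, h4, ← Complex.ofReal_add, Complex.ofReal_re]
  calc ((2 : ℝ) - n) / (8 * n)
      = ∑ i, ∑ j, Complex.normSq (X i j) * (((2 : ℝ) - n) / (8 * n)) := by
        simp_rw [← Finset.sum_mul, hw, one_mul]
    _ ≤ ∑ i, ∑ j, Complex.normSq (X i j) * (a i * a j + ∑ k, a k ^ 4) := by
        gcongr with i _ j _
        · exact Complex.normSq_nonneg _
        · exact mul_add_sum_pow_four_ge hn a ha2 i j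
    _ = ∑ i, ∑ j, Complex.normSq (X i j) * (a i * a j) + ∑ k, a k ^ 4 := by
        simp_rw [mul_add, Finset.sum_add_distrib, ← Finset.sum_mul, hw, one_mul]

theorem stmt_2 (n : ℕ) (hn : 2 ≤ n) (heven : Even n)
    (X N : Matrix (Fin n) (Fin n) ℂ)
    (hX : Xᴴ = -X) (hN : Nᴴ = -N)
    (hXtr : Matrix.trace X = 0) (hNtr : Matrix.trace N = 0)
    (hX2 : Matrix.trace (X ^ 2) = -1) (hN2 : Matrix.trace (N ^ 2) = -1)
    (hXN : Matrix.trace (X * N) = 0) :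
    (Matrix.trace ((X * N) ^ 2 + N ^ 4)).re ≥ ((2 : ℝ) - n) / (8 * n) := by
  have hA : (Complex.I • N).IsHermitian := by
    rw [IsHermitian, conjTranspose_smul, hN, Complex.star_def, Complex.conj_I, neg_smul_neg]
  let φ := Unitary.conjStarAlgAut ℂ _ (star hA.eigenvectorUnitary)
  have hφ : ∀ M, trace (φ M) = trace M := fun M => by
    rw [Unitary.conjStarAlgAut_star_apply, trace_mul_cycle,
      Unitary.mul_star_self_of_mem hA.eigenvectorUnitary.2, one_mul]
  have hφN : φ N = diagonal fun i => -Complex.I * (hA.eigenvalues i : ℂ) := by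
    have hN' : N = -Complex.I • (Complex.I • N) := by
      rw [smul_smul, neg_mul, Complex.I_mul_I, neg_neg, one_smul]
    have h : φ (Complex.I • N) = _ := hA.conjStarAlgAut_star_eigenvectorUnitary
    conv_lhs => rw [hN']
    rw [map_smul, h, ← diagonal_smul]
    rfl
  have hφX : (φ X)ᴴ = -φ X := by
    rw [← star_eq_conjTranspose, ← map_star, star_eq_conjTranspose, hX, map_neg]
  have h := trace_add_pow_four_ge_of_diagonal hn hφX (by rw [← map_pow, hφ, hX2])
    hA.eigenvalues (by rw [← hφN, ← map_pow, hφ, hN2])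
  rwa [← hφN, ← map_mul, ← map_pow, ← map_pow, ← map_add, hφ] at h
end

section
/- Let n ≥ 2 be an even integer. Then there exist n×n complex matrices X, N that are skew-Hermitian (Xᴴ = -X, Nᴴ = -N) with trace X = trace N = 0, satisfying trace (X^2) = -1, trace (N^2) = -1, trace (X*N) = 0, and such that the real part of trace ((X*N)^2 + N^4) equals (2 - n) / (8 * n). -/
open Matrix

/-- The alternating diagonal `(a, -a, c, -c, c, -c, …)`. -/
def alternatingDiagonal (m : ℕ) (a c : ℂ) : Fin (m + 2) → ℂ :=
  Fin.cons a (Fin.cons (-a) fun j : Fin m => (-1) ^ (j : ℕ) * c)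

theorem sum_alternatingDiagonal {m : ℕ} (hm : Even m) (a c : ℂ) :
    ∑ i, alternatingDiagonal m a c i = 0 := by
  simp [alternatingDiagonal, Fin.sum_univ_succ, ← Finset.sum_mul, Fin.sum_neg_one_pow, hm]

theorem sum_alternatingDiagonal_pow {m k : ℕ} (hk : Even k) (a c : ℂ) :
    ∑ i, alternatingDiagonal m a c i ^ k = 2 * a ^ k + m * c ^ k := by
  have h (j : ℕ) : ((-1 : ℂ) ^ j) ^ k = 1 := by rw [pow_right_comm, hk.neg_one_pow, one_pow]
  simp only [alternatingDiagonal, Fin.sum_univ_succ, Fin.cons_zero, Fin.cons_succ, mul_pow, h,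
    hk.neg_pow, one_mul, Finset.sum_const, Finset.card_univ, Fintype.card_fin, nsmul_eq_mul]
  ring

theorem trace_diagonal_pow {ι : Type*} [Fintype ι] [DecidableEq ι] (d : ι → ℂ) (k : ℕ) :
    trace (diagonal d ^ k) = ∑ i, d i ^ k := by
  simp [diagonal_pow, trace_diagonal]

/-- The symmetric matrix with entry `s` in positions `(0, 1)` and `(1, 0)` and zero elsewhere. -/
def swapBlock (m : ℕ) (s : ℂ) : Matrix (Fin (m + 2)) (Fin (m + 2)) ℂ :=
  single 0 1 s + single 1 0 s

theorem trace_swapBlock_sq (m : ℕ) (s : ℂ) : trace (swapBlock m s ^ 2) = 2 * s ^ 2 := by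
  simp [swapBlock, sq, add_mul, mul_add]
  ring

theorem swapBlock_mul_diagonal (m : ℕ) (s : ℂ) (d : Fin (m + 2) → ℂ) :
    swapBlock m s * diagonal d = single 0 1 (s * d 1) + single 1 0 (s * d 0) := by
  ext i j
  simp only [swapBlock, mul_diagonal, Matrix.add_apply, single_apply, add_mul, ite_mul, zero_mul]
  congr 1 <;> split_ifs with h <;> first | rfl | rw [h.2]

theorem stmt_3 (n : ℕ) (hn : 2 ≤ n) (heven : Even n) :
    ∃ X N : Matrix (Fin n) (Fin n) ℂ,
      Xᴴ = -X ∧ Nᴴ = -N ∧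
      Matrix.trace X = 0 ∧ Matrix.trace N = 0 ∧
      Matrix.trace (X ^ 2) = -1 ∧ Matrix.trace (N ^ 2) = -1 ∧
      Matrix.trace (X * N) = 0 ∧
      (Matrix.trace ((X * N) ^ 2 + N ^ 4)).re = ((2 : ℝ) - n) / (8 * n) := by
  obtain ⟨m, rfl⟩ := Nat.exists_eq_add_of_le' hn
  have hm : Even m := by simpa [Nat.even_add] using heven
  have exists_sqrt (x : ℝ) (hx : 0 ≤ x) :
      ∃ z : ℂ, star z = -z ∧ z ^ 2 = -(x : ℂ) := by
    refine ⟨Complex.I * (√x : ℝ), by simp, ?_⟩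
    rw [mul_pow, Complex.I_sq, ← Complex.ofReal_pow, Real.sq_sqrt hx]
    ring
  obtain ⟨s, hs, hs2⟩ := exists_sqrt (1 / 2) (by positivity)
  obtain ⟨a, ha, ha2⟩ := exists_sqrt ((m + 4) / (4 * (m + 2))) (by positivity)
  obtain ⟨c, hc, hc2⟩ := exists_sqrt (1 / (2 * (m + 2))) (by positivity)
  have hm0 : (m : ℂ) + 2 ≠ 0 := by exact_mod_cast (by omega : m + 2 ≠ 0)
  push_cast at hs2 ha2 hc2
  refine ⟨swapBlock m s, diagonal (alternatingDiagonal m a c), ?_, ?_, ?_, ?_, ?_, ?_, ?_, ?_⟩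
  · rw [swapBlock, conjTranspose_add, conjTranspose_single, conjTranspose_single, hs,
      neg_add, ← single_neg, ← single_neg]
    exact add_comm _ _
  · rw [diagonal_conjTranspose, diagonal_neg]
    congr 1
    ext i : 1
    refine Fin.cases ?_ (Fin.cases ?_ fun j => ?_) i <;>
      simp_all [alternatingDiagonal]
  · simp [swapBlock]
  · rw [trace_diagonal, sum_alternatingDiagonal hm]
  · rw [trace_swapBlock_sq, hs2]
    norm_num
  · rw [trace_diagonal_pow, sum_alternatingDiagonal_pow even_two, ha2, hc2]
    field_simp
    ring
  · simp [swapBlock_mul_diagonal]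
  · have hXN : trace ((swapBlock m s * diagonal (alternatingDiagonal m a c)) ^ 2)
        = -2 * s ^ 2 * a ^ 2 := by
      rw [swapBlock_mul_diagonal]
      have h0 : alternatingDiagonal m a c 0 = a := rfl
      have h1 : alternatingDiagonal m a c 1 = -a := rfl
      simp [h0, h1, sq, add_mul, mul_add]
      ring
    have hval : trace ((swapBlock m s * diagonal (alternatingDiagonal m a c)) ^ 2
        + diagonal (alternatingDiagonal m a c) ^ 4)
        = Complex.ofReal ((2 - (m + 2 : ℕ)) / (8 * (m + 2 : ℕ))) := by
      rw [trace_add, hXN, trace_diagonal_pow, sum_alternatingDiagonal_pow (by decide),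
        show a ^ 4 = (a ^ 2) ^ 2 by ring, show c ^ 4 = (c ^ 2) ^ 2 by ring, hs2, ha2, hc2]
      push_cast
      field_simp
      ring
    rw [hval, Complex.ofReal_re]
end

section
/- Let n ≥ 3 be an odd integer. Let X, N be n×n complex matrices that are skew-Hermitian (Xᴴ = -X, Nᴴ = -N) with trace X = trace N = 0, and suppose trace (X^2) = -1, trace (N^2) = -1, and trace (X*N) = 0. Then the real part of trace ((X*N)^2 + N^4) is at least (1 - n) / (8 * (n + 1)). -/
open Matrix

/-- A lower bound for `∑ wᵢⱼ lᵢ lⱼ + ∑ lᵢ⁴` over nonnegative weights `w` of total mass one and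
centred unit vectors `l`. -/
lemma weighted_sum_add_sum_pow_four_ge {n : ℕ} (l : Fin n → ℝ) (w : Fin n → Fin n → ℝ)
    (hw : ∀ i j, 0 ≤ w i j) (hw1 : ∑ i, ∑ j, w i j = 1)
    (hl : ∑ i, l i = 0) (hl2 : ∑ i, l i ^ 2 = 1) :
    ((2 : ℝ) - n) / (8 * n) ≤ ∑ i, ∑ j, w i j * (l i * l j) + ∑ i, l i ^ 4 := by
  have hne : Nonempty (Fin n) := by
    by_contra h
    rw [not_nonempty_iff] at h
    simp at hl2
  have hn : (0 : ℝ) < n := by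
    exact_mod_cast Fin.pos_iff_nonempty.mpr hne
  obtain ⟨a, ha⟩ := Finite.exists_max l
  obtain ⟨b, hb⟩ := Finite.exists_min l
  have ha0 : 0 ≤ l a := by
    by_contra! h
    have := Finset.sum_neg (s := Finset.univ) (fun i _ => (ha i).trans_lt h) Finset.univ_nonempty
    linarith
  have hb0 : l b ≤ 0 := by
    by_contra! h
    have := Finset.sum_pos (s := Finset.univ) (fun i _ => h.trans_le (hb i)) Finset.univ_nonempty
    linarith
  have hab : a ≠ b := by
    rintro rfl
    have h0 : ∀ i, l i = 0 := fun i => by linarith [ha i, hb i]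
    simp [h0] at hl2
  have hprod : ∀ i j, l a * l b ≤ l i * l j := by
    intro i j
    rcases le_total 0 (l i) with h | h
    · nlinarith [ha i, hb j]
    · nlinarith [hb i, ha j]
  have hcross : l a * l b ≤ ∑ i, ∑ j, w i j * (l i * l j) := by
    calc l a * l b = ∑ i, ∑ j, w i j * (l a * l b) := by
          simp_rw [← Finset.sum_mul]
          rw [hw1, one_mul]
      _ ≤ _ := Finset.sum_le_sum fun i _ => Finset.sum_le_sum fun j _ =>
          mul_le_mul_of_nonneg_left (hprod i j) (hw i j)
  obtain ⟨c, hc⟩ : ∃ c : ℝ, c * (2 * n) = 1 := ⟨1 / (2 * n), by field_simp⟩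
  have hsum : ∑ i, (l i ^ 2 - c) ^ 2 = ∑ i, l i ^ 4 - 2 * c + n * c ^ 2 := by
    have : ∀ i, (l i ^ 2 - c) ^ 2 = l i ^ 4 - 2 * c * l i ^ 2 + c ^ 2 := fun i => by ring
    simp [this, Finset.sum_add_distrib, Finset.sum_sub_distrib, ← Finset.mul_sum, hl2]
  have hpair : (l a ^ 2 - c) ^ 2 + (l b ^ 2 - c) ^ 2 ≤ ∑ i, (l i ^ 2 - c) ^ 2 := by
    rw [← Finset.sum_pair (f := fun i => (l i ^ 2 - c) ^ 2) hab]
    exact Finset.sum_le_sum_of_subset_of_nonneg (Finset.subset_univ _)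
      fun i _ _ => sq_nonneg _
  have hbound : ((2 : ℝ) - n) / (8 * n) = c / 2 - 1 / 8 := by
    rw [div_eq_iff (by positivity)]
    linear_combination (-2 : ℝ) * hc
  have hnc : n * c ^ 2 = c / 2 := by linear_combination c / 2 * hc
  rw [hbound]
  nlinarith [sq_nonneg (l a ^ 2 - l b ^ 2), sq_nonneg (l a ^ 2 + l b ^ 2 - 2 * c - 1 / 2),
    sq_nonneg (l a + l b)]

/-- A skew-Hermitian matrix is unitarily diagonalizable with purely imaginary diagonal. -/
lemma exists_unitary_conj_diagonal_of_skewHermitian {ι : Type*} [Fintype ι] [DecidableEq ι]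
    {N : Matrix ι ι ℂ} (hN : Nᴴ = -N) :
    ∃ (U : Matrix ι ι ℂ) (l : ι → ℝ), Uᴴ * U = 1 ∧ U * Uᴴ = 1 ∧
      N = U * diagonal (fun i => Complex.I * (l i : ℂ)) * Uᴴ := by
  have hH : (-Complex.I • N).IsHermitian := by
    simp [Matrix.IsHermitian, conjTranspose_smul, hN]
  refine ⟨hH.eigenvectorUnitary, hH.eigenvalues, ?_, ?_, ?_⟩
  · exact Unitary.coe_star_mul_self hH.eigenvectorUnitary
  · exact Unitary.coe_mul_star_self hH.eigenvectorUnitary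
  · have h := hH.spectral_theorem
    rw [Unitary.conjStarAlgAut_apply] at h
    have hdiag : diagonal (fun i => Complex.I * (hH.eigenvalues i : ℂ)) =
        Complex.I • diagonal (RCLike.ofReal ∘ hH.eigenvalues : ι → ℂ) := by
      rw [← diagonal_smul]
      rfl
    rw [hdiag, mul_smul_comm, smul_mul_assoc, ← star_eq_conjTranspose, ← h, smul_smul]
    simp

/-- For a skew-Hermitian `B` and a diagonal `D` with imaginary entries, `tr (BD)²` in terms of
entries. -/
lemma trace_mul_diagonal_sq_of_skewHermitian {ι : Type*} [Fintype ι] [DecidableEq ι]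
    {B : Matrix ι ι ℂ} (hB : Bᴴ = -B) (l : ι → ℝ) :
    trace ((B * diagonal fun i => Complex.I * (l i : ℂ)) ^ 2) =
      ((∑ i, ∑ j, Complex.normSq (B i j) * (l i * l j) : ℝ) : ℂ) := by
  rw [pow_two, trace]
  simp only [diag_apply, mul_apply (M := B * _), mul_diagonal]
  push_cast
  refine Finset.sum_congr rfl fun i _ => Finset.sum_congr rfl fun j _ => ?_
  have h : B j i = -star (B i j) := by
    have := congr_fun₂ hB j i
    rw [conjTranspose_apply, neg_apply] at this
    rw [this, neg_neg]
  rw [h, Complex.normSq_eq_conj_mul_self, ← starRingEnd_apply]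
  linear_combination (-(B i j) * (starRingEnd ℂ) (B i j) * l i * l j) * Complex.I_sq

/-- For a skew-Hermitian `B`, `tr B²` is minus the squared Frobenius norm. -/
lemma trace_sq_of_skewHermitian {ι : Type*} [Fintype ι] [DecidableEq ι]
    {B : Matrix ι ι ℂ} (hB : Bᴴ = -B) :
    trace (B ^ 2) = -((∑ i, ∑ j, Complex.normSq (B i j) : ℝ) : ℂ) := by
  have h := trace_mul_diagonal_sq_of_skewHermitian hB 1
  have hd : (diagonal fun i : ι => Complex.I * (((1 : ι → ℝ) i : ℝ) : ℂ)) =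
      Complex.I • (1 : Matrix ι ι ℂ) := by
    ext i j
    simp [diagonal_apply, one_apply]
  rw [hd, mul_smul_comm, mul_one, smul_pow, trace_smul, Complex.I_sq] at h
  simp only [Pi.one_apply, mul_one, smul_eq_mul] at h
  rw [← h]
  ring

theorem stmt_4 (n : ℕ) (hn : 3 ≤ n) (hodd : Odd n)
    (X N : Matrix (Fin n) (Fin n) ℂ)
    (hX : Xᴴ = -X) (hN : Nᴴ = -N)
    (hXtr : Matrix.trace X = 0) (hNtr : Matrix.trace N = 0)
    (hX2 : Matrix.trace (X ^ 2) = -1) (hN2 : Matrix.trace (N ^ 2) = -1)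
    (hXN : Matrix.trace (X * N) = 0) :
    (Matrix.trace ((X * N) ^ 2 + N ^ 4)).re ≥ ((1 : ℝ) - n) / (8 * (n + 1)) := by
  obtain ⟨U, l, hU, hU', rfl⟩ := exists_unitary_conj_diagonal_of_skewHermitian hN
  set D := diagonal (fun i => Complex.I * (l i : ℂ)) with hD
  obtain ⟨B, rfl⟩ : ∃ B, X = U * B * Uᴴ := ⟨Uᴴ * X * U, by
    simp only [Matrix.mul_assoc, hU', mul_one]
    rw [← Matrix.mul_assoc, hU', one_mul]⟩
  have hconj : ∀ P Q, (U * P * Uᴴ) * (U * Q * Uᴴ) = U * (P * Q) * Uᴴ := fun P Q => by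
    calc _ = U * P * (Uᴴ * U) * Q * Uᴴ := by simp only [Matrix.mul_assoc]
      _ = _ := by rw [hU, mul_one, Matrix.mul_assoc U]
  have htr : ∀ P, trace (U * P * Uᴴ) = trace P := fun P => by
    rw [trace_mul_comm, ← Matrix.mul_assoc, hU, one_mul]
  have hconj2 : ∀ P, (U * P * Uᴴ) ^ 2 = U * P ^ 2 * Uᴴ := fun P => by
    rw [pow_two, hconj, ← pow_two]
  have hB : Bᴴ = -B := by
    have h := congr_arg (fun M => Uᴴ * M * U) hX
    have hcancel : ∀ P, Uᴴ * (U * P * Uᴴ) * U = P := fun P => by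
      calc _ = (Uᴴ * U) * P * (Uᴴ * U) := by simp only [Matrix.mul_assoc]
        _ = P := by rw [hU, one_mul, mul_one]
    have hct : (U * B * Uᴴ)ᴴ = U * Bᴴ * Uᴴ := by
      simp [conjTranspose_mul, Matrix.mul_assoc]
    simpa only [hct, mul_neg, neg_mul, hcancel] using h
  rw [hconj2, htr, trace_sq_of_skewHermitian hB] at hX2
  have hw1 : ∑ i, ∑ j, Complex.normSq (B i j) = 1 := by
    exact_mod_cast neg_injective hX2
  have hl : ∑ i, l i = 0 := by
    rw [htr, hD, trace_diagonal, ← Finset.mul_sum] at hNtr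
    exact_mod_cast (mul_eq_zero.mp hNtr).resolve_left Complex.I_ne_zero
  have hl2 : ∑ i, l i ^ 2 = 1 := by
    rw [hconj2, htr, hD, diagonal_pow, trace_diagonal] at hN2
    simp only [Pi.pow_apply, mul_pow, Complex.I_sq, ← Finset.mul_sum] at hN2
    rw [neg_one_mul] at hN2
    exact_mod_cast neg_injective hN2
  have hN4 : trace ((U * D * Uᴴ) ^ 4) = ((∑ i, l i ^ 4 : ℝ) : ℂ) := by
    rw [show 4 = 2 * 2 from rfl, pow_mul, hconj2, hconj2, htr, ← pow_mul, hD, diagonal_pow,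
      trace_diagonal]
    simp [mul_pow]
  have hmain := weighted_sum_add_sum_pow_four_ge l (fun i j => Complex.normSq (B i j))
    (fun i j => Complex.normSq_nonneg _) hw1 hl hl2
  rw [trace_add, hN4, hconj, hconj2, htr, hD, trace_mul_diagonal_sq_of_skewHermitian hB,
    ← Complex.ofReal_add, Complex.ofReal_re]
  refine le_trans ?_ hmain
  have hn0 : (0 : ℝ) < n := by
    exact_mod_cast (by lia : 0 < n)
  rw [div_le_div_iff₀ (by positivity) (by positivity)]
  nlinarith
end

section
/- Let n ≥ 3 be an odd integer. Then there exist n×n complex matrices X, N that are skew-Hermitian (Xᴴ = -X, Nᴴ = -N) with trace X = trace N = 0, satisfying trace (X^2) = -1, trace (N^2) = -1, trace (X*N) = 0, and such that the real part of trace ((X*N)^2 + N^4) is at most (3 - n) / (8 * (n - 1)). -/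
open Matrix

theorem sum_neg_one_pow_mul_fin_two_mul (k : ℕ) (b : ℂ) :
    ∑ i : Fin (2 * k), (-1) ^ (i : ℕ) * b = 0 := by
  rw [← Finset.sum_mul, Fin.sum_univ_eq_sum_range (fun i => (-1 : ℂ) ^ i), neg_one_geom_sum]
  simp

/-- A skew-Hermitian matrix supported on one pair of off-diagonal entries, and a diagonal
skew-Hermitian matrix with eigenvalues `±a * I`, `0` and, `k` times each, `±b * I`. -/
theorem exists_skewHermitian_pair (k : ℕ) (a b : ℝ) :
    ∃ X N : Matrix (Fin (2 * k + 3)) (Fin (2 * k + 3)) ℂ,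
      Xᴴ = -X ∧ Nᴴ = -N ∧ trace X = 0 ∧ trace N = 0 ∧ trace (X ^ 2) = -1 ∧
      trace (N ^ 2) = ((-(2 * a ^ 2 + 2 * k * b ^ 2) : ℝ) : ℂ) ∧
      trace (X * N) = 0 ∧
      trace ((X * N) ^ 2 + N ^ 4) = ((-a ^ 2 + 2 * a ^ 4 + 2 * k * b ^ 4 : ℝ) : ℂ) := by
  obtain ⟨z, hz⟩ : ∃ z : ℂ, z * star z = 1 / 2 := by
    refine ⟨(1 + Complex.I) / 2, ?_⟩
    apply Complex.ext <;> simp <;> norm_num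
  let d : Fin (2 * k + 3) → ℂ := Fin.cons (a * Complex.I) (Fin.cons (-(a * Complex.I))
    (Fin.cons 0 fun i => (-1) ^ (i : ℕ) * (b * Complex.I)))
  have hd0 : d 0 = a * Complex.I := rfl
  have hd1 : d 1 = -(a * Complex.I) := rfl
  have hstar : star d = -d := by
    funext i
    refine Fin.cases ?_ (Fin.cases ?_ (Fin.cases ?_ fun i => ?_)) i
    · simp [d]
    · simp [d]
    · change star (0 : ℂ) = -0
      simp
    · simp [d]
  have hsum : ∀ f : ℂ → ℂ, ∑ i, f (d i) = f (a * Complex.I) + (f (-(a * Complex.I)) +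
      (f 0 + ∑ i : Fin (2 * k), f ((-1) ^ (i : ℕ) * (b * Complex.I)))) := by
    intro f
    simp [Fin.sum_univ_succ, d]
  have h01 : (0 : Fin (2 * k + 3)) ≠ 1 := by simp
  have hs (i j : Fin (2 * k + 3)) (c : ℂ) :
      single i j c * diagonal d = single i j (c * d j) := by
    ext p q
    by_cases hq : j = q <;> simp [mul_diagonal, single_apply, hq]
  refine ⟨single 0 1 z - single 1 0 (star z), diagonal d, ?_, ?_, ?_, ?_, ?_, ?_, ?_, ?_⟩
  · simp [conjTranspose_single]
  · rw [diagonal_conjTranspose, hstar, diagonal_neg]; rfl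
  · simp [trace_single_eq_of_ne, h01, h01.symm]
  · rw [trace_diagonal, hsum fun x => x, sum_neg_one_pow_mul_fin_two_mul]
    ring
  · simp only [pow_two, sub_mul, mul_sub, single_mul_single_same, trace_sub,
      single_mul_single_of_ne _ _ _ _ h01, single_mul_single_of_ne _ _ _ _ h01.symm,
      trace_single_eq_same, trace_zero]
    linear_combination -2 * hz
  · rw [diagonal_pow, trace_diagonal]
    simp only [Pi.pow_apply]
    rw [hsum fun x => x ^ 2]
    simp only [mul_pow, pow_right_comm (-1 : ℂ) _ 2, neg_sq, Complex.I_sq]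
    simp
    ring
  · simp [sub_mul, hs, trace_single_eq_of_ne, h01, h01.symm]
  · rw [trace_add, diagonal_pow, trace_diagonal]
    simp only [Pi.pow_apply]
    rw [hsum fun x => x ^ 4]
    simp only [pow_two, sub_mul, mul_sub, hs, single_mul_single_same, trace_sub,
      single_mul_single_of_ne _ _ _ _ h01, single_mul_single_of_ne _ _ _ _ h01.symm,
      trace_single_eq_same, trace_zero, hd0, hd1]
    simp only [mul_pow, pow_right_comm (-1 : ℂ) _ 4,
      Even.neg_pow (by decide : Even 4), one_pow, Complex.I_pow_four, Finset.sum_const,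
      Finset.card_univ, Fintype.card_fin, nsmul_eq_mul]
    push_cast
    linear_combination (a ^ 2 : ℂ) * Complex.I_sq +
      (2 * a ^ 2 * Complex.I ^ 2) * hz

theorem stmt_5 (n : ℕ) (hn : 3 ≤ n) (hodd : Odd n) :
    ∃ X N : Matrix (Fin n) (Fin n) ℂ,
      Xᴴ = -X ∧ Nᴴ = -N ∧
      Matrix.trace X = 0 ∧ Matrix.trace N = 0 ∧
      Matrix.trace (X ^ 2) = -1 ∧ Matrix.trace (N ^ 2) = -1 ∧
      Matrix.trace (X * N) = 0 ∧
      (Matrix.trace ((X * N) ^ 2 + N ^ 4)).re ≤ ((3 : ℝ) - n) / (8 * (n - 1)) := by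
  obtain ⟨k, rfl⟩ : ∃ k, n = 2 * k + 3 := by
    obtain ⟨m, rfl⟩ := hodd
    exact ⟨m - 1, by omega⟩
  have hk : (0 : ℝ) < k + 1 := by positivity
  have ha : √((k + 2) / (4 * (k + 1)) : ℝ) ^ 2 = (k + 2) / (4 * (k + 1)) :=
    Real.sq_sqrt (by positivity)
  have hb : √(1 / (4 * (k + 1)) : ℝ) ^ 2 = 1 / (4 * (k + 1)) := Real.sq_sqrt (by positivity)
  obtain ⟨X, N, hX, hN, hX0, hN0, hX2, hN2, hXN, htr⟩ := exists_skewHermitian_pair k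
    √((k + 2) / (4 * (k + 1))) √(1 / (4 * (k + 1)))
  refine ⟨X, N, hX, hN, hX0, hN0, hX2, ?_, hXN, ?_⟩
  · rw [hN2, ha, hb, show (-1 : ℂ) = ((-1 : ℝ) : ℂ) by simp]
    congr 1
    field_simp
    ring
  · rw [htr, Complex.ofReal_re, pow_mul _ 2 2, pow_mul _ 2 2, ha, hb]
    apply le_of_eq
    push_cast
    rw [show (2 * (k : ℝ) + 3 - 1) = 2 * (k + 1) by ring]
    field_simp
    ring
end

section
/- Let n be an integer with 2 ≤ n ≤ 17. Let X, N be n×n complex matrices that are skew-Hermitian (Xᴴ = -X, Nᴴ = -N) with trace X = trace N = 0, and suppose trace (X^2) = -1, trace (N^2) = -1, and trace (X*N) = 0. Then 1/n^2 + (Re trace ((X*N)^2 + N^4)) / (2*n) > 0. -/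
open Matrix

/-- If `∑ i, (l i) ^ 2 = 1` then `l j * l k + ∑ i, (l i) ^ 4` is at least `-(n - 2) / (8 * n)`,
which exceeds `-2 / n` when `n < 18`. -/
lemma mul_add_sum_pow_four_gt (n : ℕ) (hn : 2 ≤ n) (hn' : n ≤ 17) (l : Fin n → ℝ)
    (hl : ∑ i, l i ^ 2 = 1) (j k : Fin n) :
    -2 / (n : ℝ) < l j * l k + ∑ i, l i ^ 4 := by
  have h2 : (2 : ℝ) ≤ n := by exact_mod_cast hn
  have h17 : (n : ℝ) ≤ 17 := by exact_mod_cast hn'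
  have hn0 : (0 : ℝ) < n := by linarith
  rcases eq_or_ne j k with rfl | hjk
  · have h4 : 0 ≤ ∑ i, l i ^ 4 := Finset.sum_nonneg fun i _ => by positivity
    have : -2 / (n : ℝ) < 0 := div_neg_of_neg_of_pos (by norm_num) hn0
    nlinarith [mul_self_nonneg (l j)]
  have hsum : ∑ i, (l i ^ 2 - 1 / (2 * n)) ^ 2 = ∑ i, l i ^ 4 - 3 / (4 * n) := by
    have h : ∀ i, (l i ^ 2 - 1 / (2 * n)) ^ 2 = l i ^ 4 - (1 / n) * l i ^ 2 + 1 / (4 * n ^ 2) := by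
      intro i
      field_simp
      ring
    simp only [h, Finset.sum_add_distrib, Finset.sum_sub_distrib, ← Finset.mul_sum, hl,
      Finset.sum_const, Finset.card_univ, Fintype.card_fin, nsmul_eq_mul]
    field_simp
    ring
  have hle : (l j ^ 2 - 1 / (2 * n)) ^ 2 + (l k ^ 2 - 1 / (2 * n)) ^ 2
      ≤ ∑ i, (l i ^ 2 - 1 / (2 * n)) ^ 2 := by
    rw [← Finset.sum_pair (f := fun i => (l i ^ 2 - 1 / (2 * (n : ℝ))) ^ 2) hjk]
    exact Finset.sum_le_sum_of_subset_of_nonneg (Finset.subset_univ _)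
      fun i _ _ => sq_nonneg _
  have hinv : (1 : ℝ) / 17 ≤ 1 / n := one_div_le_one_div_of_le hn0 h17
  have e1 : -2 / (n : ℝ) = -2 * (1 / n) := by ring
  have e2 : (1 : ℝ) / (2 * n) = (1 / n) / 2 := by ring
  have e3 : (3 : ℝ) / (4 * n) = 3 * (1 / n) / 4 := by ring
  rw [e1]
  rw [e2] at hsum hle
  rw [e3] at hsum
  nlinarith [sq_nonneg (l j + l k), sq_nonneg (l j ^ 2 - 1 / 4 - (1 / (n : ℝ)) / 2),
    sq_nonneg (l k ^ 2 - 1 / 4 - (1 / (n : ℝ)) / 2)]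

/-- A skew-Hermitian matrix is unitarily diagonalizable with imaginary eigenvalues. -/
lemma exists_unitary_diagonal_of_conjTranspose_eq_neg {ι : Type*} [Fintype ι] [DecidableEq ι]
    {N : Matrix ι ι ℂ} (hN : Nᴴ = -N) :
    ∃ U : Matrix ι ι ℂ, ∃ l : ι → ℝ, Uᴴ * U = 1 ∧ U * Uᴴ = 1 ∧
      N = U * diagonal (fun i => Complex.I * (l i : ℂ)) * Uᴴ := by
  have hD : ((-Complex.I) • N).IsHermitian := by
    simp [Matrix.IsHermitian, conjTranspose_smul, hN]
  refine ⟨hD.eigenvectorUnitary, hD.eigenvalues, ?_, ?_, ?_⟩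
  · exact (Unitary.mem_iff.mp hD.eigenvectorUnitary.2).1
  · exact (Unitary.mem_iff.mp hD.eigenvectorUnitary.2).2
  · have h := hD.spectral_theorem
    rw [Unitary.conjStarAlgAut_apply] at h
    have hd : diagonal (fun i => Complex.I * (hD.eigenvalues i : ℂ))
        = Complex.I • diagonal (RCLike.ofReal ∘ hD.eigenvalues : ι → ℂ) := by
      rw [← diagonal_smul]
      rfl
    rw [hd, Matrix.mul_smul, Matrix.smul_mul]
    have h' := congrArg (Complex.I • ·) h
    simpa [smul_smul, star_eq_conjTranspose] using h'

lemma trace_mul_diagonal_sq_s6 {ι : Type*} [Fintype ι] [DecidableEq ι] {B : Matrix ι ι ℂ}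
    (hB : Bᴴ = -B) (l : ι → ℝ) :
    trace ((B * diagonal fun i => Complex.I * (l i : ℂ)) ^ 2)
      = ((∑ j, ∑ k, Complex.normSq (B j k) * (l j * l k) : ℝ) : ℂ) := by
  have hs : ∀ j k, B k j = -star (B j k) := fun j k => by
    have := congrFun (congrFun hB k) j
    simp only [conjTranspose_apply, Matrix.neg_apply] at this
    rw [this, neg_neg]
  simp only [pow_two, trace, diag_apply, mul_apply (M := B * _), mul_diagonal, Complex.ofReal_sum]
  refine Finset.sum_congr rfl fun j _ => Finset.sum_congr rfl fun k _ => ?_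
  rw [hs j k]
  push_cast
  rw [← Complex.mul_conj, Complex.star_def]
  linear_combination (-(B j k * (starRingEnd ℂ) (B j k) * l j * l k)) * Complex.I_sq

lemma trace_sq_of_conjTranspose_eq_neg {ι : Type*} [Fintype ι] [DecidableEq ι] {B : Matrix ι ι ℂ}
    (hB : Bᴴ = -B) :
    trace (B ^ 2) = ((-∑ j, ∑ k, Complex.normSq (B j k) : ℝ) : ℂ) := by
  rw [pow_two, ← neg_neg (B * B), ← Matrix.mul_neg, ← hB, trace_neg]
  simp [trace, mul_apply, Complex.mul_conj]

theorem stmt_6 (n : ℕ) (hn : 2 ≤ n) (hn' : n ≤ 17)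
    (X N : Matrix (Fin n) (Fin n) ℂ)
    (hX : Xᴴ = -X) (hN : Nᴴ = -N)
    (hXtr : Matrix.trace X = 0) (hNtr : Matrix.trace N = 0)
    (hX2 : Matrix.trace (X ^ 2) = -1) (hN2 : Matrix.trace (N ^ 2) = -1)
    (hXN : Matrix.trace (X * N) = 0) :
    1 / (n : ℝ) ^ 2 + (Matrix.trace ((X * N) ^ 2 + N ^ 4)).re / (2 * n) > 0 := by
  obtain ⟨U, l, hU, hU', hND⟩ := exists_unitary_diagonal_of_conjTranspose_eq_neg hN
  set L : Matrix (Fin n) (Fin n) ℂ := diagonal fun i => Complex.I * (l i : ℂ) with hL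
  set B := Uᴴ * X * U with hBdef
  have hB : Bᴴ = -B := by
    simp [hBdef, conjTranspose_mul, hX, Matrix.mul_assoc]
  have hXB : X = U * B * Uᴴ := by
    calc X = (U * Uᴴ) * X * (U * Uᴴ) := by simp [hU']
      _ = U * B * Uᴴ := by simp only [hBdef, Matrix.mul_assoc]
  have conj_mul : ∀ P Q, (U * P * Uᴴ) * (U * Q * Uᴴ) = U * (P * Q) * Uᴴ := fun P Q => by
    calc (U * P * Uᴴ) * (U * Q * Uᴴ) = U * P * (Uᴴ * U) * Q * Uᴴ := by
          simp only [Matrix.mul_assoc]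
      _ = U * (P * Q) * Uᴴ := by rw [hU]; simp only [Matrix.mul_one, Matrix.mul_assoc]
  have trace_conj : ∀ P, trace (U * P * Uᴴ) = trace P := fun P => by
    rw [trace_mul_comm, ← Matrix.mul_assoc, hU, Matrix.one_mul]
  have hB2 : ∑ j, ∑ k, Complex.normSq (B j k) = 1 := by
    rw [hXB, pow_two, conj_mul, trace_conj, ← pow_two, trace_sq_of_conjTranspose_eq_neg hB] at hX2
    have := congrArg Complex.re hX2
    rw [Complex.ofReal_re] at this
    simpa using this
  have hl : ∑ i, l i ^ 2 = 1 := by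
    rw [hND, pow_two, conj_mul, trace_conj, hL, diagonal_mul_diagonal, trace_diagonal] at hN2
    have := congrArg Complex.re hN2
    simpa [← pow_two, mul_pow, ← Complex.ofReal_pow] using this
  have hN4 : trace (N ^ 4) = ((∑ i, l i ^ 4 : ℝ) : ℂ) := by
    rw [show N ^ 4 = (N * N) * (N * N) by noncomm_ring, hND, conj_mul, conj_mul, trace_conj, hL,
      diagonal_mul_diagonal, diagonal_mul_diagonal, trace_diagonal, Complex.ofReal_sum]
    refine Finset.sum_congr rfl fun i _ => ?_
    push_cast
    linear_combination ((l i : ℂ) ^ 4) * Complex.I_pow_four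
  have hXN2 : trace ((X * N) ^ 2)
      = ((∑ j, ∑ k, Complex.normSq (B j k) * (l j * l k) : ℝ) : ℂ) := by
    rw [hXB, hND, conj_mul, pow_two, conj_mul, trace_conj, ← pow_two, hL,
      trace_mul_diagonal_sq_s6 hB]
  have hn0 : (0 : ℝ) < n := by positivity
  have key : -2 / (n : ℝ) < (trace ((X * N) ^ 2 + N ^ 4)).re := by
    rw [trace_add, hXN2, hN4, ← Complex.ofReal_add, Complex.ofReal_re]
    set S := ∑ i, l i ^ 4
    have hzero : ∑ j, ∑ k, Complex.normSq (B j k) * (l j * l k + S + 2 / n)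
        = (∑ j, ∑ k, Complex.normSq (B j k) * (l j * l k)) + S + 2 / n := by
      simp only [mul_add, Finset.sum_add_distrib, ← Finset.sum_mul, hB2, one_mul]
    have hpos : ∀ j k, 0 < l j * l k + S + 2 / n := fun j k => by
      have := mul_add_sum_pow_four_gt n hn hn' l hl j k
      rw [neg_div] at this
      linarith
    have hnonneg : ∀ j k, 0 ≤ Complex.normSq (B j k) * (l j * l k + S + 2 / n) := fun j k =>
      mul_nonneg (Complex.normSq_nonneg _) (hpos j k).le
    obtain ⟨j, -, hj⟩ := Finset.exists_ne_zero_of_sum_ne_zero (hB2.trans_ne one_ne_zero)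
    obtain ⟨k, -, hk⟩ := Finset.exists_ne_zero_of_sum_ne_zero hj
    have : 0 < ∑ j, ∑ k, Complex.normSq (B j k) * (l j * l k + S + 2 / n) :=
      Finset.sum_pos' (fun j _ => Finset.sum_nonneg fun k _ => hnonneg j k)
        ⟨j, Finset.mem_univ _, Finset.sum_pos' (fun k _ => hnonneg j k)
          ⟨k, Finset.mem_univ _,
            mul_pos ((Complex.normSq_nonneg _).lt_of_ne' hk) (hpos j k)⟩⟩
    rw [neg_div]
    linarith
  have h := div_lt_div_of_pos_right key (by positivity : (0 : ℝ) < 2 * n)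
  have e : -2 / (n : ℝ) / (2 * n) = -(1 / (n : ℝ) ^ 2) := by
    field_simp
  linarith
end

section
/- Let X, N be 18×18 complex matrices that are skew-Hermitian (Xᴴ = -X, Nᴴ = -N) with trace X = trace N = 0, and suppose trace (X^2) = -1, trace (N^2) = -1, and trace (X*N) = 0. Then 1/324 + (Re trace ((X*N)^2 + N^4)) / 36 ≥ 0. -/
open Matrix

/-- If the squares of the `d i` sum to one over an index set of size eighteen, every product of two
of them is at least `-(1 / 9 + ∑ d ^ 4)`. -/
theorem neg_le_mul_of_sum_sq_eq_one {d : Fin 18 → ℝ} (hd : ∑ i, d i ^ 2 = 1) (j k : Fin 18) :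
    -(1 / 9 + ∑ i, d i ^ 4) ≤ d j * d k := by
  rcases eq_or_ne j k with rfl | hjk
  · have : 0 ≤ ∑ i, d i ^ 4 := Finset.sum_nonneg fun i _ => by positivity
    nlinarith [mul_self_nonneg (d j)]
  · have hk : k ∈ Finset.univ.erase j := by simp [hjk.symm]
    have split (f : Fin 18 → ℝ) :
        ∑ i, f i = f j + (f k + ∑ i ∈ (Finset.univ.erase j).erase k, f i) := by
      rw [Finset.add_sum_erase _ _ hk, Finset.add_sum_erase _ _ (Finset.mem_univ j)]
    have hcard : ((Finset.univ.erase j).erase k).card = 16 := by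
      rw [Finset.card_erase_of_mem hk, Finset.card_erase_of_mem (Finset.mem_univ j)]
      simp
    have hcs := sq_sum_le_card_mul_sum_sq (s := (Finset.univ.erase j).erase k)
      (f := fun i => d i ^ 2)
    simp only [hcard, ← pow_mul] at hcs
    rw [split] at hd ⊢
    have hrest : ∑ i ∈ (Finset.univ.erase j).erase k, d i ^ 2 = 1 - d j ^ 2 - d k ^ 2 := by
      linarith
    rw [hrest] at hcs
    norm_num at hcs
    nlinarith [sq_nonneg (d j ^ 2 - d k ^ 2), sq_nonneg (d j + d k),
      sq_nonneg (9 * (d j ^ 2 + d k ^ 2) - 5)]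

/-- For skew-Hermitian `Z` and real diagonal `D`, the trace of `Z D Z D` is a weighted sum of the
squared moduli of the entries of `Z`. -/
theorem trace_mul_diagonal_mul_mul_diagonal {n : Type*} [Fintype n] [DecidableEq n]
    {Z : Matrix n n ℂ} (hZ : Zᴴ = -Z) (d e : n → ℝ) :
    trace (Z * diagonal (fun i => (d i : ℂ)) * (Z * diagonal (fun i => (e i : ℂ)))) =
      ((-∑ j, ∑ k, Complex.normSq (Z j k) * (d k * e j) : ℝ) : ℂ) := by
  have hentry (j k : n) : Z k j = -(starRingEnd ℂ) (Z j k) := by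
    have h := congrFun (congrFun hZ k) j
    rw [conjTranspose_apply, neg_apply] at h
    rw [starRingEnd_apply, h, neg_neg]
  push_cast
  simp only [trace, diag_apply, mul_apply (M := Z * _), mul_diagonal, ← Finset.sum_neg_distrib]
  refine Finset.sum_congr rfl fun j _ => Finset.sum_congr rfl fun k _ => ?_
  rw [Complex.normSq_eq_conj_mul_self, hentry j k]
  ring

/-- A Hermitian matrix is unitarily diagonalizable with real eigenvalues. -/
theorem Matrix.IsHermitian.exists_eq_mul_diagonal_mul {n : Type*} [Fintype n] [DecidableEq n]
    {H : Matrix n n ℂ} (hH : H.IsHermitian) :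
    ∃ (d : n → ℝ) (U V : Matrix n n ℂ), U * V = 1 ∧ V * U = 1 ∧ V = Uᴴ ∧
      H = U * diagonal (fun i => (d i : ℂ)) * V :=
  ⟨hH.eigenvalues, hH.eigenvectorUnitary, star (hH.eigenvectorUnitary : Matrix n n ℂ),
    Unitary.mul_star_self_of_mem hH.eigenvectorUnitary.2,
    Unitary.star_mul_self_of_mem hH.eigenvectorUnitary.2, rfl,
    hH.spectral_theorem.trans (Unitary.conjStarAlgAut_apply _ _)⟩

theorem stmt_8 (X N : Matrix (Fin 18) (Fin 18) ℂ)
    (hX : Xᴴ = -X) (hN : Nᴴ = -N)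
    (hXtr : Matrix.trace X = 0) (hNtr : Matrix.trace N = 0)
    (hX2 : Matrix.trace (X ^ 2) = -1) (hN2 : Matrix.trace (N ^ 2) = -1)
    (hXN : Matrix.trace (X * N) = 0) :
    1 / 324 + (Matrix.trace ((X * N) ^ 2 + N ^ 4)).re / 36 ≥ 0 := by
  have hH : (Complex.I • N).IsHermitian := by
    simp [IsHermitian, conjTranspose_smul, hN]
  obtain ⟨d, U, V, hUV, hVU, hV, hspec⟩ := hH.exists_eq_mul_diagonal_mul
  set D : Matrix (Fin 18) (Fin 18) ℂ := diagonal (fun i => (d i : ℂ)) with hD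
  set Z := V * X * U with hZdef
  have hZ : Zᴴ = -Z := by
    simp [hZdef, hV, conjTranspose_mul, hX, Matrix.mul_assoc]
  have hXeq : X = U * Z * V := by
    simp only [hZdef, Matrix.mul_assoc, hUV, Matrix.mul_one]
    rw [← Matrix.mul_assoc, hUV, Matrix.one_mul]
  have hNeq : N = U * (-Complex.I • D) * V := by
    have h := congrArg (fun M => -Complex.I • M) hspec
    simpa [smul_smul] using h
  have hconj (A B : Matrix (Fin 18) (Fin 18) ℂ) : U * A * V * (U * B * V) = U * (A * B) * V := by
    calc U * A * V * (U * B * V) = U * A * (V * U) * B * V := by simp only [Matrix.mul_assoc]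
      _ = U * (A * B) * V := by rw [hVU, Matrix.mul_one, Matrix.mul_assoc U]
  have htr (A : Matrix (Fin 18) (Fin 18) ℂ) : trace (U * A * V) = trace A := by
    rw [trace_mul_comm, ← Matrix.mul_assoc, hVU, Matrix.one_mul]
  have hsum : ∑ i, d i ^ 2 = 1 := by
    rw [hNeq, pow_two, hconj, htr] at hN2
    simp only [hD, smul_mul_smul_comm, diagonal_mul_diagonal, trace_smul, trace_diagonal] at hN2
    have : (∑ i, (d i : ℂ) * d i) = 1 := by simpa using hN2
    simp only [pow_two]
    exact_mod_cast this
  have hN4 : trace (N ^ 4) = ((∑ i, d i ^ 4 : ℝ) : ℂ) := by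
    rw [hNeq, show 4 = 2 * 2 from rfl, pow_mul, pow_two, pow_two, hconj, hconj, htr]
    simp only [hD, smul_mul_smul_comm, diagonal_mul_diagonal, trace_smul, trace_diagonal]
    push_cast
    simp
    exact Finset.sum_congr rfl fun i _ => by ring
  have hZ2 : ∑ j, ∑ k, Complex.normSq (Z j k) = 1 := by
    have h := trace_mul_diagonal_mul_mul_diagonal hZ 1 1
    rw [hXeq, pow_two, hconj, htr] at hX2
    simp only [Pi.one_apply, Complex.ofReal_one, diagonal_one, hX2, mul_one] at h
    have h' : (-1 : ℝ) = -∑ j, ∑ k, Complex.normSq (Z j k) := by exact_mod_cast h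
    linarith
  have hXN2 : trace ((X * N) ^ 2) =
      ((∑ j, ∑ k, Complex.normSq (Z j k) * (d k * d j) : ℝ) : ℂ) := by
    rw [hXeq, hNeq, pow_two, hconj, hconj, htr]
    have h := trace_mul_diagonal_mul_mul_diagonal hZ d d
    rw [← hD] at h
    rw [mul_smul_comm, smul_mul_smul_comm, trace_smul, h]
    simp
  have hbound : -(1 / 9 + ∑ i, d i ^ 4) ≤
      ∑ j, ∑ k, Complex.normSq (Z j k) * (d k * d j) := by
    calc -(1 / 9 + ∑ i, d i ^ 4)
        = ∑ j, ∑ k, Complex.normSq (Z j k) * -(1 / 9 + ∑ i, d i ^ 4) := by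
          simp only [← Finset.sum_mul, hZ2, one_mul]
      _ ≤ _ := Finset.sum_le_sum fun j _ => Finset.sum_le_sum fun k _ =>
          mul_le_mul_of_nonneg_left (neg_le_mul_of_sum_sq_eq_one hsum k j)
            (Complex.normSq_nonneg _)
  rw [trace_add, hXN2, hN4, Complex.add_re, Complex.ofReal_re, Complex.ofReal_re]
  linarith
end

section
/- Let n ≥ 1 and let X, N be n×n quaternionic matrices that are skew-Hermitian, i.e. Xᴴ = -X and Nᴴ = -N, where ᴴ denotes the quaternionic conjugate transpose. Define the inner product ⟨A, B⟩ = 4*(n+1) * Re (trace (A * Bᴴ)), where Re denotes the real part of a quaternion. Suppose ⟨X, X⟩ = 1 and ⟨N, N⟩ = 1. Then ⟨N*X, X*N⟩ + ⟨N^2, N^2⟩ ≥ -1/(4*(n+1)). -/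
open Matrix Quaternion

namespace Matrix

variable {m n p : Type*} [Fintype m] [Fintype n] [Fintype p]

theorem re_trace_mul_conjTranspose_self (A : Matrix m n ℍ[ℝ]) :
    (trace (A * Aᴴ)).re = ∑ i, ∑ j, ‖A i j‖ ^ 2 := by
  have hre (s : Finset m) (f : m → ℍ[ℝ]) : (∑ i ∈ s, f i).re = ∑ i ∈ s, (f i).re :=
    map_sum (QuaternionAlgebra.reₗ (-1 : ℝ) 0 (-1)) f s
  have hre' (s : Finset n) (f : n → ℍ[ℝ]) : (∑ i ∈ s, f i).re = ∑ i ∈ s, (f i).re :=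
    map_sum (QuaternionAlgebra.reₗ (-1 : ℝ) 0 (-1)) f s
  simp only [trace, diag_apply, mul_apply, conjTranspose_apply, hre, hre',
    Quaternion.self_mul_star, Quaternion.re_coe, Quaternion.normSq_eq_norm_mul_self, sq]

theorem re_trace_mul_conjTranspose_self_nonneg (A : Matrix m n ℍ[ℝ]) :
    0 ≤ (trace (A * Aᴴ)).re := by
  rw [re_trace_mul_conjTranspose_self]
  positivity

/-- The Frobenius norm of quaternionic matrices is submultiplicative. -/
theorem re_trace_mul_mul_conjTranspose_le (A : Matrix m n ℍ[ℝ]) (B : Matrix n p ℍ[ℝ]) :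
    (trace ((A * B) * (A * B)ᴴ)).re ≤ (trace (A * Aᴴ)).re * (trace (B * Bᴴ)).re := by
  simp only [re_trace_mul_conjTranspose_self]
  rw [Finset.sum_comm (f := fun i j => ‖B i j‖ ^ 2), Finset.sum_mul_sum]
  gcongr with i _ k _
  calc ‖(A * B) i k‖ ^ 2 ≤ (∑ j, ‖A i j‖ * ‖B j k‖) ^ 2 := by
        gcongr
        simpa only [mul_apply, norm_mul] using norm_sum_le Finset.univ fun j => A i j * B j k
    _ ≤ _ := Finset.sum_mul_sq_le_sq_mul_sq _ _ _

theorem neg_le_two_mul_re_trace_mul_conjTranspose (A B : Matrix m n ℍ[ℝ]) :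
    -((trace (A * Aᴴ)).re + (trace (B * Bᴴ)).re) ≤ 2 * (trace (A * Bᴴ)).re := by
  have hsymm : (trace (B * Aᴴ)).re = (trace (A * Bᴴ)).re := by
    rw [← Quaternion.re_star (trace (A * Bᴴ)), ← trace_conjTranspose, conjTranspose_mul,
      conjTranspose_conjTranspose]
  have h := re_trace_mul_conjTranspose_self_nonneg (A + B)
  simp only [conjTranspose_add, Matrix.add_mul, Matrix.mul_add, trace_add,
    Quaternion.re_add, hsymm] at h
  linarith

end Matrix

theorem stmt_9 (n : ℕ) (hn : 1 ≤ n) (X N : Matrix (Fin n) (Fin n) ℍ[ℝ])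
    (hX : Xᴴ = -X) (hN : Nᴴ = -N)
    (hXnorm : 4 * ((n : ℝ) + 1) * (Matrix.trace (X * Xᴴ)).re = 1)
    (hNnorm : 4 * ((n : ℝ) + 1) * (Matrix.trace (N * Nᴴ)).re = 1) :
    4 * ((n : ℝ) + 1) * (Matrix.trace ((N * X) * (X * N)ᴴ)).re
      + 4 * ((n : ℝ) + 1) * (Matrix.trace (N ^ 2 * (N ^ 2)ᴴ)).re
      ≥ -1 / (4 * ((n : ℝ) + 1)) := by
  have hc : 0 < 4 * ((n : ℝ) + 1) := by positivity
  have hCS := neg_le_two_mul_re_trace_mul_conjTranspose (N * X) (X * N)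
  have hNX := re_trace_mul_mul_conjTranspose_le N X
  have hXN := re_trace_mul_mul_conjTranspose_le X N
  have hN2 := mul_nonneg hc.le (re_trace_mul_conjTranspose_self_nonneg (N ^ 2))
  rw [eq_div_of_mul_eq hc.ne' ((mul_comm _ _).trans hXnorm),
    eq_div_of_mul_eq hc.ne' ((mul_comm _ _).trans hNnorm)] at hNX hXN
  generalize 4 * ((n : ℝ) + 1) = c at *
  have hlow : -(1 / c * (1 / c)) ≤ (trace ((N * X) * (X * N)ᴴ)).re := by linarith
  have hscaled := mul_le_mul_of_nonneg_left hlow hc.le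
  have hcancel : c * -(1 / c * (1 / c)) = -1 / c := by field_simp
  linarith
end

section
/- Let m₁, m₂ be real numbers with 0 < m₁ ≤ m₂, and set θ₀ = (1/2) * arctan (√(m₂/m₁)). Then 0 < θ₀ < π/4, and for every θ with 0 < θ < π/4 one has (cos (2θ))^{m₁} * (sin (2θ))^{m₂} ≤ (cos (2θ₀))^{m₁} * (sin (2θ₀))^{m₂} (real powers), with equality if and only if θ = θ₀. -/
open Real

/-- Among points of the open first quadrant of the unit circle, the monomial `c ^ m₁ * s ^ m₂` is
strictly largest at the point whose squared coordinates are proportional to the exponents. -/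
theorem rpow_mul_rpow_lt_of_sq_add_sq_eq_one {m₁ m₂ k c s c₀ s₀ : ℝ} (hk : 0 < k)
    (hc : 0 < c) (hs : 0 < s) (hc₀ : 0 < c₀) (hs₀ : 0 < s₀)
    (h : c ^ 2 + s ^ 2 = 1) (h₀ : c₀ ^ 2 + s₀ ^ 2 = 1)
    (hm₁ : m₁ = k * c₀ ^ 2) (hm₂ : m₂ = k * s₀ ^ 2) (hne : c ≠ c₀) :
    c ^ m₁ * s ^ m₂ < c₀ ^ m₁ * s₀ ^ m₂ := by
  have hlog_c : 2 * (log c - log c₀) < (c / c₀) ^ 2 - 1 := by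
    have hsq : (c / c₀) ^ 2 ≠ 1 := by
      rw [Ne, pow_eq_one_iff_of_nonneg (by positivity) two_ne_zero,
        div_eq_one_iff_eq hc₀.ne']
      exact hne
    have := log_lt_sub_one_of_pos (by positivity) hsq
    rwa [log_pow, log_div hc.ne' hc₀.ne', Nat.cast_ofNat] at this
  have hlog_s : 2 * (log s - log s₀) ≤ (s / s₀) ^ 2 - 1 := by
    have := log_le_sub_one_of_pos (x := (s / s₀) ^ 2) (by positivity)
    rwa [log_pow, log_div hs.ne' hs₀.ne', Nat.cast_ofNat] at this
  have hc_scaled := mul_lt_mul_of_pos_left hlog_c (show 0 < m₁ by rw [hm₁]; positivity)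
  have hs_scaled := mul_le_mul_of_nonneg_left hlog_s (show 0 ≤ m₂ by rw [hm₂]; positivity)
  have hsum : m₁ * ((c / c₀) ^ 2 - 1) + m₂ * ((s / s₀) ^ 2 - 1) = 0 := by
    rw [hm₁, hm₂]
    field_simp
    linear_combination k * (h - h₀)
  rw [← log_lt_log_iff (by positivity) (by positivity), log_mul (by positivity) (by positivity),
    log_mul (by positivity) (by positivity), log_rpow hc, log_rpow hs, log_rpow hc₀, log_rpow hs₀]
  linarith

theorem stmt_15 (m₁ m₂ : ℝ) (hm₁ : 0 < m₁) (hm : m₁ ≤ m₂)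
    (θ₀ : ℝ) (hθ₀ : θ₀ = (1 / 2) * Real.arctan (Real.sqrt (m₂ / m₁))) :
    0 < θ₀ ∧ θ₀ < π / 4 ∧
    ∀ θ : ℝ, 0 < θ → θ < π / 4 →
      Real.cos (2 * θ) ^ m₁ * Real.sin (2 * θ) ^ m₂ ≤
        Real.cos (2 * θ₀) ^ m₁ * Real.sin (2 * θ₀) ^ m₂ ∧
      (Real.cos (2 * θ) ^ m₁ * Real.sin (2 * θ) ^ m₂ =
        Real.cos (2 * θ₀) ^ m₁ * Real.sin (2 * θ₀) ^ m₂ ↔ θ = θ₀) := by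
  have hm₂ : 0 < m₂ := hm₁.trans_le hm
  have htwo : 2 * θ₀ = arctan √(m₂ / m₁) := by rw [hθ₀]; ring
  have hpos : 0 < θ₀ := by
    have := arctan_pos.mpr (sqrt_pos.mpr (div_pos hm₂ hm₁))
    linarith
  have hlt : θ₀ < π / 4 := by
    have := arctan_lt_pi_div_two √(m₂ / m₁)
    linarith
  refine ⟨hpos, hlt, fun θ hθ hθ' ↦ ?_⟩
  have hcos : ∀ x, 0 < x → x < π / 4 → 0 < cos (2 * x) := fun x hx hx' ↦
    cos_pos_of_mem_Ioo ⟨by linarith [pi_pos], by linarith⟩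
  have hsin : ∀ x, 0 < x → x < π / 4 → 0 < sin (2 * x) := fun x hx hx' ↦
    sin_pos_of_pos_of_lt_pi (by linarith) (by linarith [pi_pos])
  have hm₁_eq : m₁ = (m₁ + m₂) * cos (2 * θ₀) ^ 2 := by
    rw [htwo, cos_sq_arctan, sq_sqrt (by positivity)]
    field_simp
  have hm₂_eq : m₂ = (m₁ + m₂) * sin (2 * θ₀) ^ 2 := by
    rw [htwo, sin_sq_arctan, sq_sqrt (by positivity)]
    field_simp
  have hstrict (hne : θ ≠ θ₀) : cos (2 * θ) ^ m₁ * sin (2 * θ) ^ m₂ <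
      cos (2 * θ₀) ^ m₁ * sin (2 * θ₀) ^ m₂ := by
    refine rpow_mul_rpow_lt_of_sq_add_sq_eq_one (add_pos hm₁ hm₂) (hcos θ hθ hθ') (hsin θ hθ hθ')
      (hcos θ₀ hpos hlt) (hsin θ₀ hpos hlt) (cos_sq_add_sin_sq _) (cos_sq_add_sin_sq _)
      hm₁_eq hm₂_eq fun heq ↦ hne ?_
    have := injOn_cos ⟨by linarith, by linarith [pi_pos]⟩ ⟨by linarith, by linarith [pi_pos]⟩ heq
    linarith
  rcases eq_or_ne θ θ₀ with rfl | hne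
  · simp
  · exact ⟨(hstrict hne).le, fun heq ↦ absurd heq (hstrict hne).ne, fun heq ↦ absurd heq hne⟩
end
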